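/- Let (Ω, F, P, (T_x)_{x∈Z^2}) be a measure-preserving Z^2-system and B a stationary integrable additive cocycle recovering weights: ω(x) = min(B(x,x+e1), B(x,x+e2)) with ω(x) = W(T_x ω) for an integrable W. If a sequence of lattice points x_n along an up-right path satisfies (1/|x_n|_1) (G(u, x_n) − h·x_n) → 0 a.s. where h = (E[B(0,e1)], E[B(0,e2)]), and by concavity g(ζ) − h·ζ < 0 for every direction ζ in a closed set C, then a.s. the limit points of x_n/|x_n|_1 avoid C. -/

import Mathlib

open Filter Topology MeasureTheory ProbabilityTheory

/-- Lattice points of `ℤ²`. -/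
abbrev Pt : Type := ℤ × ℤ

/-- The step `e₁ = (1,0)`. -/
def pe1 : Pt := (1, 0)

/-- The step `e₂ = (0,1)`. -/
def pe2 : Pt := (0, 1)

/-- `x` is an up-right path on the index range `[m, n]`. -/
def IsUpRight (x : ℕ → Pt) (m n : ℕ) : Prop :=
  ∀ k, m ≤ k → k < n → x (k + 1) = x k + pe1 ∨ x (k + 1) = x k + pe2

/-- The weight collected by the path `x` over indices `m ≤ k < n`
(the endpoint's weight is not counted). -/
def pathSum (ω : Pt → ℝ) (x : ℕ → Pt) (m n : ℕ) : ℝ :=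
  ∑ k ∈ Finset.Ico m n, ω (x k)

/-- Last-passage time from `u` to `v`: the maximal weight over up-right paths. -/
noncomputable def lppG (ω : Pt → ℝ) (u v : Pt) : ℝ :=
  sSup {s : ℝ | ∃ (n : ℕ) (x : ℕ → Pt),
    IsUpRight x 0 n ∧ x 0 = u ∧ x n = v ∧ s = pathSum ω x 0 n}

/-- Extended-real last-passage time; equals `⊥ = -∞` when no up-right path
from `u` to `v` exists. -/
noncomputable def lppGE (ω : Pt → ℝ) (u v : Pt) : EReal :=
  sSup {s : EReal | ∃ (n : ℕ) (x : ℕ → Pt),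
    IsUpRight x 0 n ∧ x 0 = u ∧ x n = v ∧ s = ((pathSum ω x 0 n : ℝ) : EReal)}

/-- Additivity of a cocycle: `B(x,y) + B(y,z) = B(x,z)`. -/
def IsCocycle (B : Pt → Pt → ℝ) : Prop := ∀ x y z : Pt, B x y + B y z = B x z

/-- `B` recovers the weights `ω`. -/
def Recovers (B : Pt → Pt → ℝ) (ω : Pt → ℝ) : Prop :=
  ∀ x : Pt, ω x = min (B x (x + pe1)) (B x (x + pe2))

/-- The `ℓ¹`-norm of a lattice point, as a real number. -/
def l1norm (p : Pt) : ℝ := ((|p.1| + |p.2| : ℤ) : ℝ)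

/-- The direction of a lattice point: `p / |p|₁ ∈ ℝ²`. -/
noncomputable def dirOf (p : Pt) : ℝ × ℝ :=
  ((p.1 : ℝ) / l1norm p, (p.2 : ℝ) / l1norm p)

/-- Dot product of a real vector with a lattice point. -/
def dotPt (h : ℝ × ℝ) (p : Pt) : ℝ := h.1 * (p.1 : ℝ) + h.2 * (p.2 : ℝ)

/-- After `n` steps, an up-right path started at `u` sits at `u + z` with `z ≥ 0` and `|z|₁ = n`. -/
theorem IsUpRight.displacement {x : ℕ → Pt} (hx : ∀ n, IsUpRight x 0 n) (n : ℕ) :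
    0 ≤ x n - x 0 ∧ (x n - x 0).1 + (x n - x 0).2 = (n : ℤ) := by
  induction n with
  | zero => simp
  | succ n ih =>
    obtain ⟨⟨h1, h2⟩, h3⟩ := ih
    simp only [Prod.fst_zero, Prod.snd_zero, Prod.fst_sub, Prod.snd_sub] at h1 h2 h3
    rcases hx (n + 1) n n.zero_le n.lt_succ_self with h | h <;> rw [h] <;>
      refine ⟨⟨?_, ?_⟩, ?_⟩ <;> simp [pe1, pe2] <;> omega

/-- The `ℓ¹`-norm along an up-right path is asymptotic to the number of steps. -/
theorem IsUpRight.tendsto_l1norm_div {x : ℕ → Pt} (hx : ∀ n, IsUpRight x 0 n) :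
    Tendsto (fun n : ℕ => l1norm (x n) / (n : ℝ)) atTop (𝓝 1) := by
  have hbound : ∀ n : ℕ, |l1norm (x n) - n| ≤ l1norm (x 0) := by
    intro n
    obtain ⟨⟨h1, h2⟩, h3⟩ := IsUpRight.displacement hx n
    simp only [Prod.fst_zero, Prod.snd_zero, Prod.fst_sub, Prod.snd_sub] at h1 h2 h3
    have key : |(|(x n).1| + |(x n).2|) - (n : ℤ)| ≤ |(x 0).1| + |(x 0).2| := by
      simp only [abs, max_def]
      split_ifs <;> omega
    unfold l1norm
    exact_mod_cast key
  have hdiff : Tendsto (fun n : ℕ => (l1norm (x n) - n) / (n : ℝ)) atTop (𝓝 0) := by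
    refine squeeze_zero_norm (fun n => ?_)
      (tendsto_const_div_atTop_nhds_zero_nat (l1norm (x 0)))
    rw [Real.norm_eq_abs, abs_div, Nat.abs_cast]
    gcongr
    exact hbound n
  have hsum := hdiff.add_const 1
  rw [zero_add] at hsum
  refine hsum.congr' ?_
  filter_upwards [eventually_gt_atTop 0] with n hn
  have : (n : ℝ) ≠ 0 := by positivity
  field_simp
  ring

/-- If `G` has asymptotic shape `g` and grows like `h · x_n` along an up-right path `x`, then
`g ζ = h · ζ` at every limit direction `ζ` of the path. -/
theorem IsUpRight.shape_eq_of_mapClusterPt {x : ℕ → Pt} (hx : ∀ n, IsUpRight x 0 n)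
    {g : ℝ × ℝ → ℝ} (hgc : Continuous g)
    (hghom : ∀ c : ℝ, 0 ≤ c → ∀ p : ℝ × ℝ, 0 ≤ p.1 → 0 ≤ p.2 → g (c • p) = c * g p)
    {G : ℕ → ℝ} {h : ℝ × ℝ}
    (hshape : Tendsto (fun n : ℕ =>
      (G n - g (((x n - x 0).1 : ℝ), ((x n - x 0).2 : ℝ))) / (n : ℝ)) atTop (𝓝 0))
    (hconv : Tendsto (fun n : ℕ => (G n - dotPt h (x n)) / l1norm (x n)) atTop (𝓝 0))
    {ζ : ℝ × ℝ} (hζ : MapClusterPt ζ atTop (fun n : ℕ => dirOf (x n))) :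
    g ζ = h.1 * ζ.1 + h.2 * ζ.2 := by
  obtain ⟨U, hU, hlim⟩ := mapClusterPt_iff_ultrafilter.1 hζ
  have hN := IsUpRight.tendsto_l1norm_div hx
  have hne : ∀ᶠ n : ℕ in atTop, (n : ℝ) ≠ 0 ∧ l1norm (x n) ≠ 0 := by
    filter_upwards [hN.eventually_ne one_ne_zero] with n hn
    exact ⟨fun h0 => hn (by simp [h0]), fun h0 => hn (by simp [h0])⟩
  set d : ℕ → ℝ × ℝ := fun n =>
    (((x n - x 0).1 : ℝ) / n, ((x n - x 0).2 : ℝ) / n) with hd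
  have hd1 : Tendsto (fun n => (d n).1) U (𝓝 ζ.1) := by
    have := (((continuous_fst.tendsto ζ).comp hlim).mul (hN.mono_left hU)).sub
      ((tendsto_const_div_atTop_nhds_zero_nat ((x 0).1 : ℝ)).mono_left hU)
    rw [mul_one, sub_zero] at this
    refine this.congr' ?_
    filter_upwards [hU hne] with n ⟨hn, hl⟩
    simp only [hd, dirOf, Function.comp, Prod.fst_sub, Int.cast_sub]
    field_simp
  have hd2 : Tendsto (fun n => (d n).2) U (𝓝 ζ.2) := by
    have := (((continuous_snd.tendsto ζ).comp hlim).mul (hN.mono_left hU)).sub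
      ((tendsto_const_div_atTop_nhds_zero_nat ((x 0).2 : ℝ)).mono_left hU)
    rw [mul_one, sub_zero] at this
    refine this.congr' ?_
    filter_upwards [hU hne] with n ⟨hn, hl⟩
    simp only [hd, dirOf, Function.comp, Prod.snd_sub, Int.cast_sub]
    field_simp
  have hgd : Tendsto (fun n => g (d n) - (h.1 * (d n).1 + h.2 * (d n).2)) U
      (𝓝 (g ζ - (h.1 * ζ.1 + h.2 * ζ.2))) :=
    ((hgc.tendsto ζ).comp (hd1.prodMk_nhds hd2)).sub
      ((hd1.const_mul h.1).add (hd2.const_mul h.2))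
  have hzero : Tendsto (fun n => g (d n) - (h.1 * (d n).1 + h.2 * (d n).2)) atTop (𝓝 0) := by
    have := ((hconv.mul hN).sub hshape).add
      (tendsto_const_div_atTop_nhds_zero_nat (dotPt h (x 0)))
    rw [zero_mul, sub_zero, add_zero] at this
    refine this.congr' ?_
    filter_upwards [hne] with n ⟨hn, hl⟩
    obtain ⟨⟨h1, h2⟩, -⟩ := IsUpRight.displacement hx n
    have hg : g (d n) = (n : ℝ)⁻¹ * g (((x n - x 0).1 : ℝ), ((x n - x 0).2 : ℝ)) := by
      rw [← hghom _ (by positivity) _ (Int.cast_nonneg h1) (Int.cast_nonneg h2)]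
      simp only [hd, Prod.smul_mk, smul_eq_mul, div_eq_inv_mul]
    rw [hg]
    simp only [hd, dotPt, Prod.fst_sub, Prod.snd_sub, Int.cast_sub]
    field_simp
    ring
  exact sub_eq_zero.1 (tendsto_nhds_unique hgd (hzero.mono_left hU))

/-- in a last-passage system with an additive, weight-recovering
stationary cocycle of mean vector `h`, if along a random up-right path
`(G(u,x_n) - h·x_n)/|x_n|₁ → 0` a.s., the shape theorem holds for the limit shape `g`
(continuous and 1-homogeneous on `ℝ₊²`), and `g(ζ) - h·ζ < 0` for every direction `ζ`
in a closed set `C ⊆ U`, then almost surely no limit point of `x_n/|x_n|₁` lies in `C`. -/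
theorem path_directions_avoid_negative_set
    {Ω : Type*} [MeasurableSpace Ω] (μ : Measure Ω) [IsProbabilityMeasure μ]
    (T : Pt → Ω → Ω)
    (hT : ∀ z : Pt, MeasurePreserving (T z) μ μ)
    (W : Ω → Pt → ℝ) (B : Ω → Pt → Pt → ℝ)
    (hadd : ∀ᵐ a ∂μ, IsCocycle (B a))
    (hrec : ∀ᵐ a ∂μ, Recovers (B a) (W a))
    (hstatW : ∀ᵐ a ∂μ, ∀ z : Pt, W a z = W (T z a) 0)
    (hstatB : ∀ᵐ a ∂μ, ∀ z x y : Pt, B a (z + x) (z + y) = B (T z a) x y)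
    (hBint : ∀ x y : Pt, Integrable (fun a => B a x y) μ)
    (h : ℝ × ℝ)
    (hmean : (∫ a, B a 0 pe1 ∂μ) = h.1 ∧ (∫ a, B a 0 pe2 ∂μ) = h.2)
    (g : ℝ × ℝ → ℝ) (hgc : Continuous g)
    (hghom : ∀ c : ℝ, 0 ≤ c → ∀ p : ℝ × ℝ, 0 ≤ p.1 → 0 ≤ p.2 → g (c • p) = c * g p)
    -- the shape theorem for `G`
    (hshape : ∀ᵐ a ∂μ, ∀ (w : Pt) (z : ℕ → Pt),
      (∀ n : ℕ, 0 ≤ z n ∧ (z n).1 + (z n).2 = (n : ℤ)) →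
      Filter.Tendsto
        (fun n : ℕ => (lppG (W a) w (w + z n) - g (((z n).1 : ℝ), ((z n).2 : ℝ))) / (n : ℝ))
        Filter.atTop (nhds 0))
    (u : Pt) (x : Ω → ℕ → Pt)
    (hpath : ∀ᵐ a ∂μ, x a 0 = u ∧ ∀ n : ℕ, IsUpRight (x a) 0 n)
    (C : Set (ℝ × ℝ)) (hC : IsClosed C)
    (hCU : C ⊆ {p : ℝ × ℝ | 0 ≤ p.1 ∧ 0 ≤ p.2 ∧ p.1 + p.2 = 1})
    (hneg : ∀ ζ ∈ C, g ζ - (h.1 * ζ.1 + h.2 * ζ.2) < 0)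
    (hconv : ∀ᵐ a ∂μ, Filter.Tendsto
      (fun n : ℕ => (lppG (W a) u (x a n) - dotPt h (x a n)) / l1norm (x a n))
      Filter.atTop (nhds 0)) :
    ∀ᵐ a ∂μ, ∀ ζ ∈ C, ¬ MapClusterPt ζ Filter.atTop (fun n : ℕ => dirOf (x a n)) := by
  filter_upwards [hshape, hpath, hconv] with a hs hp hc ζ hζ hcl
  obtain ⟨rfl, hup⟩ := hp
  have hs' := hs (x a 0) (fun n => x a n - x a 0) (IsUpRight.displacement hup)
  simp only [add_sub_cancel] at hs'
  have := IsUpRight.shape_eq_of_mapClusterPt hup hgc hghom hs' hc hcl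
  linarith [hneg ζ hζ]
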